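/- Let c(n) denote the number of ≡_3-equivalence classes of binary trees of arity n. Then, as formal power series, (1 − t)^2 · ∑_{n≥1} c(n) t^n = t · (1 − t + t^2 + t^3 + 2t^4 + 2t^5 − 7t^7 − 2t^8 + t^9 + 2t^{10} + t^{11}); i.e., the Hilbert series of the 3-comb associative operad CAs_3 equals t(1 − t + t^2 + t^3 + 2t^4 + 2t^5 − 7t^7 − 2t^8 + t^9 + 2t^{10} + t^{11})/(1 − t)^2. -/

import Mathlib

/-- A binary tree: either a leaf or an ordered pair of binary trees. -/
inductive BTree : Type
  | leaf : BTree
  | node : BTree → BTree → BTree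
  deriving DecidableEq

namespace BTree

/-- The arity of a binary tree is its number of leaves. -/
def arity : BTree → ℕ
  | leaf => 1
  | node l r => arity l + arity r

/-- The degree of a binary tree is its number of internal nodes. -/
def degree : BTree → ℕ
  | leaf => 0
  | node l r => degree l + degree r + 1

/-- Grafting `t ∘ᵢ s`: identify the root of `s` with the `i`-th leaf of `t`
(leaves numbered from left to right, starting at `1`). -/
def graft : BTree → ℕ → BTree → BTree
  | leaf, i, s => if i = 1 then s else leaf
  | node l r, i, s =>
      if i ≤ l.arity then node (l.graft i s) r else node l (r.graft (i - l.arity) s)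

/-- Simultaneous grafting `s ∘ [r_1, …, r_n]`: graft the `i`-th element of the
list onto the `i`-th leaf of `s`, simultaneously. -/
def multigraft : BTree → List BTree → BTree
  | leaf, rs => rs.headD leaf
  | node l r, rs => node (l.multigraft (rs.take l.arity)) (r.multigraft (rs.drop l.arity))

/-- The left comb with `γ` internal nodes. -/
def leftComb : ℕ → BTree
  | 0 => leaf
  | γ + 1 => node (leftComb γ) leaf

/-- The right comb with `γ` internal nodes. -/
def rightComb : ℕ → BTree
  | 0 => leaf
  | γ + 1 => node leaf (rightComb γ)

/-- The prefix word of a binary tree, over the alphabet `{0, 2}`: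
a left-to-right depth-first traversal writes `2` for each internal node and
`0` for each leaf. -/
def prefixWord : BTree → List ℕ
  | leaf => [0]
  | node l r => 2 :: (prefixWord l ++ prefixWord r)

/-- The left rank: number of internal nodes on the leftmost branch from the root. -/
def leftRank : BTree → ℕ
  | leaf => 0
  | node l _ => leftRank l + 1

/-- The mirror of a binary tree. -/
def mirror : BTree → BTree
  | leaf => leaf
  | node l r => node (mirror r) (mirror l)

end BTree

/-- One step of the rewrite relation induced by a set of rewrite rules `R`:
`r ∘ᵢ (s ∘ [r_1, …, r_n]) ⇒ r ∘ᵢ (s' ∘ [r_1, …, r_n])` whenever `R s s'`. -/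
def Step (R : BTree → BTree → Prop) (t t' : BTree) : Prop :=
  ∃ (s s' r : BTree) (i : ℕ) (rs : List BTree),
    R s s' ∧ 1 ≤ i ∧ i ≤ r.arity ∧ rs.length = s.arity ∧
    t = r.graft i (s.multigraft rs) ∧ t' = r.graft i (s'.multigraft rs)

/-- The congruence generated by a set of rewrite rules: the reflexive–symmetric–transitive
closure of the induced rewrite relation. -/
def CongrGen (R : BTree → BTree → Prop) : BTree → BTree → Prop :=
  Relation.EqvGen (Step R)

/-- The tree `s` occurs as a subtree of `t`. -/
def Occurs (s t : BTree) : Prop :=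
  ∃ (r : BTree) (i : ℕ) (rs : List BTree),
    1 ≤ i ∧ i ≤ r.arity ∧ rs.length = s.arity ∧ t = r.graft i (s.multigraft rs)

/-- The rewrite relation induced by `R` is terminating: there is no infinite
chain `t_0 ⇒ t_1 ⇒ t_2 ⇒ ⋯`. -/
def Terminating (R : BTree → BTree → Prop) : Prop :=
  ¬ ∃ f : ℕ → BTree, ∀ n, Step R (f n) (f (n + 1))

/-- The rewrite relation induced by `R` is confluent. -/
def Confluent (R : BTree → BTree → Prop) : Prop :=
  ∀ t s₁ s₂, Relation.ReflTransGen (Step R) t s₁ → Relation.ReflTransGen (Step R) t s₂ →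
    ∃ t', Relation.ReflTransGen (Step R) s₁ t' ∧ Relation.ReflTransGen (Step R) s₂ t'

/-- The number of equivalence classes of binary trees of arity `n` under the
equivalence relation `E`. -/
noncomputable def classCount (E : BTree → BTree → Prop) (n : ℕ) : ℕ :=
  Nat.card (Quot fun a b : {t : BTree // t.arity = n} => E a.1 b.1)

/-- The congruence `≡_γ` generated by the single rewrite rule `(L_γ, R_γ)`. -/
def CAsCongr (γ : ℕ) : BTree → BTree → Prop :=
  CongrGen fun s s' => s = BTree.leftComb γ ∧ s' = BTree.rightComb γ

/-! ### The congruence `CAsCongr 3` and its quotient -/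

/-- Equivalence relations on binary trees compatible with `node` and identifying both sides of
every instance of the rule `L₃ → R₃`. -/
structure IsCombCongr (E : BTree → BTree → Prop) : Prop where
  equiv : Equivalence E
  node : ∀ {a a' b b'}, E a a' → E b b' → E (BTree.node a b) (BTree.node a' b')
  comb : ∀ a b c d, E (.node (.node (.node a b) c) d) (.node a (.node b (.node c d)))

theorem IsCombCongr.graft {E : BTree → BTree → Prop} (hE : IsCombCongr E) {u u' : BTree}
    (h : E u u') (r : BTree) (i : ℕ) : E (r.graft i u) (r.graft i u') := by
  induction r generalizing i with
  | leaf =>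
    simp only [BTree.graft]
    split_ifs
    exacts [h, hE.equiv.refl _]
  | node l r ihl ihr =>
    simp only [BTree.graft]
    split_ifs
    exacts [hE.node (ihl _) (hE.equiv.refl _), hE.node (hE.equiv.refl _) (ihr _)]

theorem IsCombCongr.of_casCongr {E : BTree → BTree → Prop} (hE : IsCombCongr E) {t t' : BTree}
    (h : CAsCongr 3 t t') : E t t' := by
  induction h with
  | rel t t' h =>
    obtain ⟨_, _, r, i, rs, ⟨rfl, rfl⟩, -, -, hrs, rfl, rfl⟩ := h
    apply hE.graft
    match rs, hrs with
    | [a, b, c, d], _ => exact hE.comb a b c d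
  | refl t => exact hE.equiv.refl t
  | symm _ _ _ ih => exact hE.equiv.symm ih
  | trans _ _ _ _ _ ih ih' => exact hE.equiv.trans ih ih'

theorem Step.node_left {R : BTree → BTree → Prop} {t t' : BTree} (h : Step R t t') (u : BTree) :
    Step R (.node t u) (.node t' u) := by
  obtain ⟨s, s', r, i, rs, hR, hi, hi', hrs, rfl, rfl⟩ := h
  refine ⟨s, s', .node r u, i, rs, hR, hi, ?_, hrs, ?_, ?_⟩ <;>
    simp [BTree.arity, BTree.graft, hi']
  omega

theorem Step.node_right {R : BTree → BTree → Prop} {t t' : BTree} (h : Step R t t') (u : BTree) :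
    Step R (.node u t) (.node u t') := by
  obtain ⟨s, s', r, i, rs, hR, hi, hi', hrs, rfl, rfl⟩ := h
  have : ¬ i + u.arity ≤ u.arity := by omega
  refine ⟨s, s', .node u r, i + u.arity, rs, hR, by omega, ?_, hrs, ?_, ?_⟩ <;>
    simp [BTree.arity, BTree.graft, this]
  omega

theorem isCombCongr_casCongr : IsCombCongr (CAsCongr 3) where
  equiv := Relation.EqvGen.is_equivalence _
  node {a a' b b'} ha hb := by
    have hl : CAsCongr 3 (.node a b) (.node a' b) := by
      induction ha with
      | rel _ _ h => exact .rel _ _ (h.node_left b)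
      | refl => exact .refl _
      | symm _ _ _ ih => exact .symm _ _ ih
      | trans _ _ _ _ _ ih ih' => exact .trans _ _ _ ih ih'
    have hr : CAsCongr 3 (.node a' b) (.node a' b') := by
      clear hl
      induction hb with
      | rel _ _ h => exact .rel _ _ (h.node_right a')
      | refl => exact .refl _
      | symm _ _ _ ih => exact .symm _ _ ih
      | trans _ _ _ _ _ ih ih' => exact .trans _ _ _ ih ih'
    exact .trans _ _ _ hl hr
  comb a b c d := .rel _ _
    ⟨_, _, .leaf, 1, [a, b, c, d], ⟨rfl, rfl⟩, le_rfl, le_rfl, rfl, rfl, rfl⟩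

/-- The underlying magma of the operad `CAs₃`: binary trees modulo `≡₃`. -/
def CAs : Type := Quot (CAsCongr 3)

namespace CAs

/-- The class of a binary tree. -/
def mk (t : BTree) : CAs := Quot.mk _ t

theorem mk_surjective : Function.Surjective mk := Quot.mk_surjective

theorem mk_eq_mk {t t' : BTree} : mk t = mk t' ↔ CAsCongr 3 t t' :=
  isCombCongr_casCongr.equiv.quot_mk_eq_iff _ _

instance : Mul CAs :=
  ⟨Quot.map₂ BTree.node
    (fun _ _ _ h => isCombCongr_casCongr.node (isCombCongr_casCongr.equiv.refl _) h)
    (fun _ _ _ h => isCombCongr_casCongr.node h (isCombCongr_casCongr.equiv.refl _))⟩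

theorem mk_node (l r : BTree) : mk (.node l r) = mk l * mk r := rfl

theorem comb3 (a b c d : CAs) : ((a * b) * c) * d = a * (b * (c * d)) := by
  obtain ⟨a, rfl⟩ := mk_surjective a
  obtain ⟨b, rfl⟩ := mk_surjective b
  obtain ⟨c, rfl⟩ := mk_surjective c
  obtain ⟨d, rfl⟩ := mk_surjective d
  exact Quot.sound (isCombCongr_casCongr.comb a b c d)

theorem rule1 (a b c d e : CAs) :
    (a * (b * (c * d))) * e =
      (a * b) * (c * (d * e)) := by
  rw [← comb3 a b c d, comb3 (a * b) c d e]

theorem rule2 (a b c d e f : CAs) :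
    a * (b * ((c * (d * e)) * f)) =
      a * (b * (c * (d * (e * f)))) := by
  rw [← comb3 a b (c * (d * e)) f, rule1 (a * b) c d e f, comb3 a b c (d * (e * f))]

theorem rule3 (a b c d e f : CAs) :
    a * ((b * (c * d)) * (e * f)) =
      a * (b * (c * (d * (e * f)))) := by
  rw [← comb3 a (b * (c * d)) e f, rule1 a b c d e, comb3 a b (c * (d * e)) f, rule2 a b c d e f]

theorem rule4 (a b c d e f g : CAs) :
    a * (b * ((c * d) * (e * (f * g)))) =
      a * (b * (c * (d * ((e * f) * g)))) := by
  rw [← rule2 a b (c * d) e f g, comb3 c d (e * f) g]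

theorem rule5 (a b c d e f g : CAs) :
    a * ((b * c) * (d * (e * (f * g)))) =
      a * (b * (c * ((d * e) * (f * g)))) := by
  rw [← rule3 a (b * c) d e f g, comb3 b c (d * e) (f * g)]

theorem rule6 (a b c d e f g : CAs) :
    (a * ((b * c) * d)) * (e * (f * g)) =
      (a * b) * (c * (d * (e * (f * g)))) := by
  rw [← rule1 a ((b * c) * d) e f g, comb3 b c d (e * f), rule1 a b c (d * (e * f)) g,
    rule2 (a * b) c d e f g]

theorem rule7 (a b c d e f g h : CAs) :
    a * (b * (c * (d * ((e * f) * (g * h))))) =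
      a * (b * (c * (d * (e * ((f * g) * h))))) := by
  rw [← rule4 a b c d e f (g * h), ← rule3 a b (c * d) e f (g * h), rule6 b c d e f g h,
    rule5 a b c d e f (g * h), rule4 b c d e f g h]

theorem rule8 (a b c d e f g h : CAs) :
    a * (b * (c * ((d * e) * ((f * g) * h)))) =
      a * (b * (c * (d * (e * (f * (g * h)))))) := by
  rw [← rule4 a b c (d * e) f g h, rule2 a b c d e (f * (g * h))]

theorem rule9 (a b c d e f g h : CAs) :
    (a * b) * (c * (d * ((e * f) * (g * h)))) =
      (a * b) * (c * (d * (e * ((f * g) * h)))) := by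
  rw [← comb3 d (e * f) g h, ← rule1 a b c ((d * (e * f)) * g) h, rule2 b c d e f g,
    rule1 a b c (d * (e * (f * g))) h, rule2 (a * b) c d e (f * g) h]

theorem rule10 (a b c d e f g h : CAs) :
    (a * (b * c)) * (d * (e * (f * (g * h)))) =
      (a * b) * (c * (d * (e * ((f * g) * h)))) := by
  rw [← rule1 a (b * c) d e (f * (g * h)), rule6 a b c (d * e) f g h, rule4 (a * b) c d e f g h]

/-! ### Invariants -/

theorem arity_eq_of_mk_eq {t t' : BTree} (h : mk t = mk t') : t.arity = t'.arity := by
  refine IsCombCongr.of_casCongr (E := fun t t' => t.arity = t'.arity) ⟨?_, ?_, ?_⟩ (mk_eq_mk.1 h)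
  · exact ⟨fun _ => rfl, Eq.symm, Eq.trans⟩
  · intro a a' b b' ha hb
    simp [BTree.arity, ha, hb]
  · intro a b c d
    simp only [BTree.arity]
    omega

theorem leftRank_mod_two_eq_of_mk_eq {t t' : BTree} (h : mk t = mk t') :
    t.leftRank % 2 = t'.leftRank % 2 := by
  refine IsCombCongr.of_casCongr (E := fun t t' => t.leftRank % 2 = t'.leftRank % 2)
    ⟨?_, ?_, ?_⟩ (mk_eq_mk.1 h)
  · exact ⟨fun _ => rfl, Eq.symm, Eq.trans⟩
  · intro a a' b b' ha hb
    simp only [BTree.leftRank]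
    omega
  · intro a b c d
    simp only [BTree.leftRank]
    omega

theorem leftRank_mirror_mod_two_eq_of_mk_eq {t t' : BTree} (h : mk t = mk t') :
    t.mirror.leftRank % 2 = t'.mirror.leftRank % 2 := by
  refine IsCombCongr.of_casCongr
    (E := fun t t' => t.mirror.leftRank % 2 = t'.mirror.leftRank % 2)
    ⟨?_, ?_, ?_⟩ (mk_eq_mk.1 h)
  · exact ⟨fun _ => rfl, Eq.symm, Eq.trans⟩
  · intro a a' b b' ha hb
    simp only [BTree.leftRank, BTree.mirror]
    omega
  · intro a b c d
    simp only [BTree.leftRank, BTree.mirror]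
    omega

end CAs

/-! ### Evaluation in small arities -/

namespace BTree

local infixr:67 " ⋏ " => node

/-- Multiplication of normal forms for the convergent completion of `L₃ → R₃`, with bounded
recursion depth. -/
def mulNF : ℕ → BTree → BTree → BTree
  | 0, l, r => node l r
  | k + 1, l, r =>
      match l, r with
      | (a ⋏ b) ⋏ c, d => mulNF k a (mulNF k b (mulNF k c d))
      | a ⋏ b ⋏ c ⋏ d, e => mulNF k (mulNF k a b) (mulNF k c (mulNF k d e))
      | a, b ⋏ (c ⋏ d ⋏ e) ⋏ f => mulNF k a (mulNF k b (mulNF k c (mulNF k d (mulNF k e f))))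
      | a, (b ⋏ c ⋏ d) ⋏ e ⋏ f => mulNF k a (mulNF k b (mulNF k c (mulNF k d (mulNF k e f))))
      | a, b ⋏ (c ⋏ d) ⋏ e ⋏ f ⋏ g =>
          mulNF k a (mulNF k b (mulNF k c (mulNF k d (mulNF k (mulNF k e f) g))))
      | a, (b ⋏ c) ⋏ d ⋏ e ⋏ f ⋏ g =>
          mulNF k a (mulNF k b (mulNF k c (mulNF k (mulNF k d e) (mulNF k f g))))
      | a ⋏ (b ⋏ c) ⋏ d, e ⋏ f ⋏ g =>
          mulNF k (mulNF k a b) (mulNF k c (mulNF k d (mulNF k e (mulNF k f g))))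
      | a, b ⋏ c ⋏ d ⋏ (e ⋏ f) ⋏ g ⋏ h =>
          mulNF k a (mulNF k b (mulNF k c (mulNF k d (mulNF k e (mulNF k (mulNF k f g) h)))))
      | a, b ⋏ c ⋏ (d ⋏ e) ⋏ (f ⋏ g) ⋏ h =>
          mulNF k a (mulNF k b (mulNF k c (mulNF k d (mulNF k e (mulNF k f (mulNF k g h))))))
      | a ⋏ b, c ⋏ d ⋏ (e ⋏ f) ⋏ g ⋏ h =>
          mulNF k (mulNF k a b) (mulNF k c (mulNF k d (mulNF k e (mulNF k (mulNF k f g) h))))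
      | a ⋏ b ⋏ c, d ⋏ e ⋏ f ⋏ g ⋏ h =>
          mulNF k (mulNF k a b) (mulNF k c (mulNF k d (mulNF k e (mulNF k (mulNF k f g) h))))
      | l, r => node l r

/-- Multiplication of normal forms of small arity. -/
def mul (a b : BTree) : BTree := mulNF 20 a b

/-- The normal form of a binary tree. -/
def eval : BTree → BTree
  | leaf => leaf
  | node l r => mul (eval l) (eval r)

/-- The lists of normal forms of arities `1, …, k`. -/
def nfLevels : ℕ → List (List BTree)
  | 0 => []
  | k + 1 => nfLevels k ++ [if k = 0 then [leaf] else
      ((List.range k).flatMap fun i =>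
        ((nfLevels k).getD i []).flatMap fun a =>
          ((nfLevels k).getD (k - 1 - i) []).map fun b => mul a b).dedup]

/-- The list of normal forms of arity `n`. -/
def nfs (n : ℕ) : List BTree := (nfLevels n).getD (n - 1) []

theorem length_nfLevels (k : ℕ) : (nfLevels k).length = k := by
  induction k with
  | zero => rfl
  | succ k ih => simp [nfLevels, ih]

theorem nfLevels_getD {j k : ℕ} (h : j < k) : (nfLevels k).getD j [] = nfs (j + 1) := by
  induction k with
  | zero => omega
  | succ k ih =>
    rcases Nat.lt_succ_iff_lt_or_eq.1 h with h | rfl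
    · rw [nfLevels, List.getD_append _ _ _ _ (by rwa [length_nfLevels]), ih h]
    · rfl

theorem nodup_nfs (n : ℕ) : (nfs n).Nodup := by
  rcases n with _ | k
  · simp [nfs, nfLevels]
  · rw [nfs, nfLevels, Nat.add_sub_cancel, List.getD_append_right _ _ _ _ (length_nfLevels k).le]
    simp only [length_nfLevels, Nat.sub_self, List.getD_cons_zero]
    split_ifs
    · simp
    · exact List.nodup_dedup _

theorem mem_nfs_one {t : BTree} : t ∈ nfs 1 ↔ t = leaf := by
  simp [nfs, nfLevels]

theorem mem_nfs {k : ℕ} (hk : 2 ≤ k) {t : BTree} :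
    t ∈ nfs k ↔ ∃ i j, 1 ≤ i ∧ 1 ≤ j ∧ i + j = k ∧ ∃ a ∈ nfs i, ∃ b ∈ nfs j, mul a b = t := by
  obtain ⟨k, rfl⟩ : ∃ m, k = m + 1 := ⟨k - 1, by omega⟩
  rw [nfs, nfLevels, Nat.add_sub_cancel, List.getD_append_right _ _ _ _ (length_nfLevels k).le]
  have hk' : k ≠ 0 := by omega
  simp only [length_nfLevels, Nat.sub_self, List.getD_cons_zero, if_neg hk', List.mem_dedup,
    List.mem_flatMap, List.mem_range, List.mem_map]
  constructor
  · rintro ⟨i, hi, a, ha, b, hb, rfl⟩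
    rw [nfLevels_getD (by omega)] at ha hb
    exact ⟨_, _, by omega, by omega, by omega, a, ha, b, hb, rfl⟩
  · rintro ⟨i, j, hi, hj, hij, a, ha, b, hb, rfl⟩
    refine ⟨i - 1, by omega, a, ?_, b, ?_, rfl⟩
    · rwa [nfLevels_getD (by omega), Nat.sub_add_cancel hi]
    · rwa [nfLevels_getD (by omega), show k - 1 - (i - 1) + 1 = j by omega]

theorem one_le_arity (t : BTree) : 1 ≤ t.arity := by
  induction t with
  | leaf => rfl
  | node l r ihl ihr => simp only [arity]; omega

theorem eval_mem_nfs (t : BTree) : eval t ∈ nfs t.arity := by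
  induction t with
  | leaf => exact mem_nfs_one.2 rfl
  | node l r ihl ihr =>
    have hl := one_le_arity l
    have hr := one_le_arity r
    exact (mem_nfs (by simp only [arity]; omega)).2 ⟨_, _, hl, hr, rfl, _, ihl, _, ihr, rfl⟩

theorem exists_eval_eq {n : ℕ} (hn : 1 ≤ n) {s : BTree} (hs : s ∈ nfs n) :
    ∃ t, t.arity = n ∧ eval t = s := by
  induction n using Nat.strong_induction_on generalizing s with
  | _ n ih =>
    obtain rfl | hn2 : n = 1 ∨ 2 ≤ n := by omega
    · exact ⟨leaf, rfl, (mem_nfs_one.1 hs).symm⟩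
    · obtain ⟨i, j, hi, hj, rfl, a, ha, b, hb, rfl⟩ := (mem_nfs hn2).1 hs
      obtain ⟨l, rfl, rfl⟩ := ih i (by omega) hi ha
      obtain ⟨r, rfl, rfl⟩ := ih j (by omega) hj hb
      exact ⟨node l r, rfl, rfl⟩

open CAs in
theorem mk_mulNF (k : ℕ) (l r : BTree) : mk (mulNF k l r) = mk l * mk r := by
  induction k generalizing l r with
  | zero => rfl
  | succ k ih =>
    unfold mulNF
    split <;> simp only [ih, mk_node]
    · rw [comb3]
    · rw [rule1]
    · rw [rule2]
    · rw [rule3]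
    · rw [rule4]
    · rw [rule5]
    · rw [rule6]
    · rw [rule7]
    · rw [rule8]
    · rw [rule9]
    · rw [rule10]

theorem mk_eval (t : BTree) : CAs.mk (eval t) = CAs.mk t := by
  induction t with
  | leaf => rfl
  | node l r ihl ihr => rw [eval, mul, mk_mulNF, ihl, ihr, CAs.mk_node]

set_option synthInstance.maxSize 1000 in
set_option synthInstance.maxHeartbeats 400000 in
theorem mul_comb3_of_mem_nfs : ∀ i < 7, ∀ j < 7 - i, ∀ k < 7 - i - j, ∀ l < 7 - i - j - k,
    ∀ a ∈ nfs (i + 1), ∀ b ∈ nfs (j + 1), ∀ c ∈ nfs (k + 1), ∀ d ∈ nfs (l + 1),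
      mul (mul (mul a b) c) d = mul a (mul b (mul c d)) := by
  decide +kernel

theorem eval_eq_of_mk_eq {t t' : BTree} (h : CAs.mk t = CAs.mk t') (ht : t.arity ≤ 10) :
    eval t = eval t' := by
  refine (IsCombCongr.of_casCongr
    (E := fun t t' => t.arity = t'.arity ∧ (t.arity ≤ 10 → eval t = eval t'))
    ⟨⟨fun _ => ⟨rfl, fun _ => rfl⟩, ?_, ?_⟩, ?_, ?_⟩ (CAs.mk_eq_mk.1 h)).2 ht
  · exact fun h => ⟨h.1.symm, fun h' => (h.2 (h.1 ▸ h')).symm⟩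
  · exact fun h h' => ⟨h.1.trans h'.1, fun hx => (h.2 hx).trans (h'.2 (h.1 ▸ hx))⟩
  · intro a a' b b' ha hb
    simp only [arity, eval]
    refine ⟨by rw [ha.1, hb.1], fun h => ?_⟩
    rw [ha.2 (by omega), hb.2 (by omega)]
  · intro a b c d
    simp only [arity, eval]
    refine ⟨by omega, fun h => ?_⟩
    have key := mul_comb3_of_mem_nfs (a.arity - 1) ?_ (b.arity - 1) ?_ (c.arity - 1) ?_
      (d.arity - 1) ?_ (eval a) ?_ (eval b) ?_ (eval c) ?_ (eval d) ?_
    · exact key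
    all_goals
      have := one_le_arity a
      have := one_le_arity b
      have := one_le_arity c
      have := one_le_arity d
      first
        | omega
        | rw [Nat.sub_add_cancel (one_le_arity _)]; exact eval_mem_nfs _

end BTree

/-! ### Rigid trees -/

namespace BTree

/-- The zigzag of degree `k`, whose root turns right (`true`) or left (`false`). -/
def zigzag : Bool → ℕ → BTree
  | _, 0 => leaf
  | true, k + 1 => node leaf (zigzag false k)
  | false, k + 1 => node (zigzag true k) leaf

theorem arity_zigzag (b : Bool) (k : ℕ) : (zigzag b k).arity = k + 1 := by
  induction k generalizing b with
  | zero => cases b <;> rfl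
  | succ k ih =>
    cases b
    · simp only [zigzag, arity, ih]
    · simp only [zigzag, arity, ih]
      omega

/-- The trees to which neither `L₃ → R₃` nor its inverse applies. -/
def IsRigid (t : BTree) : Prop :=
  t = leaf ∨ ∃ i j, t = node (zigzag true i) (zigzag false j)

theorem isRigid_zigzag (b : Bool) (k : ℕ) : IsRigid (zigzag b k) := by
  rcases k with _ | k
  · cases b <;> exact .inl rfl
  · cases b
    · exact .inr ⟨k, 0, rfl⟩
    · exact .inr ⟨0, k, rfl⟩

theorem isRigid_node_iff {l r : BTree} :
    IsRigid (node l r) ↔ ∃ i j, l = zigzag true i ∧ r = zigzag false j := by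
  simp [IsRigid]

theorem not_isRigid_left (a b c d : BTree) : ¬ IsRigid (node (node (node a b) c) d) := by
  rw [isRigid_node_iff]
  rintro ⟨_ | i, j, h, -⟩ <;> simp [zigzag] at h

theorem not_isRigid_right (a b c d : BTree) : ¬ IsRigid (node a (node b (node c d))) := by
  rw [isRigid_node_iff]
  rintro ⟨i, _ | j, -, h⟩ <;> simp [zigzag] at h

theorem IsRigid.eq_of_mk_eq {t t' : BTree} (ht : IsRigid t) (h : CAs.mk t = CAs.mk t') :
    t = t' := by
  refine IsCombCongr.of_casCongr (E := fun t t' => IsRigid t ∨ IsRigid t' → t = t')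
    ⟨⟨fun _ _ => rfl, ?_, ?_⟩, ?_, ?_⟩ (CAs.mk_eq_mk.1 h) (.inl ht)
  · exact fun h h' => (h h'.symm).symm
  · rintro x y z h h' (hx | hz)
    · obtain rfl := h (.inl hx)
      exact h' (.inl hx)
    · obtain rfl := h' (.inr hz)
      exact h (.inr hz)
  · rintro a a' b b' ha hb (h | h) <;> obtain ⟨i, j, rfl, rfl⟩ := isRigid_node_iff.1 h
    · rw [ha (.inl (isRigid_zigzag _ _)), hb (.inl (isRigid_zigzag _ _))]
    · rw [ha (.inr (isRigid_zigzag _ _)), hb (.inr (isRigid_zigzag _ _))]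
  · rintro a b c d (h | h)
    · exact absurd h (not_isRigid_left _ _ _ _)
    · exact absurd h (not_isRigid_right _ _ _ _)

/-- The list of rigid trees of arity `n`, for `2 ≤ n`. -/
def rigids (n : ℕ) : List BTree :=
  (List.range (n - 1)).map fun i => node (zigzag true i) (zigzag false (n - 2 - i))

theorem length_rigids (n : ℕ) : (rigids n).length = n - 1 := by
  simp [rigids]

theorem isRigid_of_mem_rigids {n : ℕ} {t : BTree} (h : t ∈ rigids n) : IsRigid t := by
  obtain ⟨i, -, rfl⟩ := List.mem_map.1 h
  exact .inr ⟨_, _, rfl⟩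

theorem arity_of_mem_rigids {n : ℕ} {t : BTree} (h : t ∈ rigids n) : t.arity = n := by
  obtain ⟨i, hi, rfl⟩ := List.mem_map.1 h
  have := List.mem_range.1 hi
  simp only [arity, arity_zigzag]
  omega

theorem IsRigid.mem_rigids {t : BTree} (h : IsRigid t) (ht : 2 ≤ t.arity) :
    t ∈ rigids t.arity := by
  obtain rfl | ⟨i, j, rfl⟩ := h
  · simp [arity] at ht
  · refine List.mem_map.2 ⟨i, List.mem_range.2 ?_, ?_⟩
    · simp only [arity, arity_zigzag]
      omega
    · simp only [arity, arity_zigzag]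
      congr 2
      omega

theorem nodup_rigids (n : ℕ) : (rigids n).Nodup := by
  refine List.Nodup.map (fun i j h => ?_) List.nodup_range
  have := congrArg arity (node.inj h).1
  simpa [arity_zigzag] using this

end BTree

/-! ### Redexes -/

namespace CAs

/-- An element of `CAs` represented by a tree on which the rule applies at the root. -/
def HasRedex (q : CAs) : Prop := ∃ a b c d : CAs, q = ((a * b) * c) * d

theorem hasRedex_right (a b c d : CAs) : HasRedex (a * (b * (c * d))) :=
  ⟨a, b, c, d, (comb3 a b c d).symm⟩

theorem HasRedex.mul_right {p : CAs} (h : HasRedex p) (q : CAs) : HasRedex (p * q) := by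
  obtain ⟨a, b, c, d, rfl⟩ := h
  exact ⟨a * b, c, d, q, rfl⟩

theorem HasRedex.mul_left {q : CAs} (h : HasRedex q) (p : CAs) : HasRedex (p * q) := by
  obtain ⟨a, b, c, d, rfl⟩ := h
  rw [comb3]
  exact hasRedex_right p a b (c * d)

theorem not_hasRedex_of_isRigid {t : BTree} (ht : t.IsRigid) : ¬ HasRedex (mk t) := by
  rintro ⟨a, b, c, d, h⟩
  obtain ⟨a, rfl⟩ := mk_surjective a
  obtain ⟨b, rfl⟩ := mk_surjective b
  obtain ⟨c, rfl⟩ := mk_surjective c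
  obtain ⟨d, rfl⟩ := mk_surjective d
  simp only [← mk_node] at h
  exact BTree.not_isRigid_left a b c d (ht.eq_of_mk_eq h ▸ ht)

theorem isRigid_or_hasRedex (t : BTree) : t.IsRigid ∨ HasRedex (mk t) := by
  induction t with
  | leaf => exact .inl (.inl rfl)
  | node l r ihl ihr =>
    rcases ihl with hl | hl
    swap
    · exact .inr (hl.mul_right (mk r))
    rcases ihr with hr | hr
    swap
    · exact .inr (hr.mul_left (mk l))
    rw [mk_node]
    have hl' : (∃ i, l = .zigzag true i) ∨ HasRedex (mk l * mk r) := by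
      obtain rfl | ⟨_ | i, j, rfl⟩ := hl
      · exact .inl ⟨0, rfl⟩
      · exact .inl ⟨j + 1, rfl⟩
      · exact .inr ⟨mk .leaf, mk (.zigzag false i), mk (.zigzag false j), mk r, rfl⟩
    have hr' : (∃ i, r = .zigzag false i) ∨ HasRedex (mk l * mk r) := by
      obtain rfl | ⟨i, _ | j, rfl⟩ := hr
      · exact .inl ⟨0, rfl⟩
      · exact .inl ⟨i + 1, rfl⟩
      · exact .inr (hasRedex_right (mk l) (mk (.zigzag true i)) (mk (.zigzag true j)) (mk .leaf))
    rcases hl' with ⟨i, rfl⟩ | h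
    · rcases hr' with ⟨j, rfl⟩ | h
      · exact .inl (.inr ⟨i, j, rfl⟩)
      · exact .inr h
    · exact .inr h

/-- The possible left factors in `exists_shortFactor_mul`. -/
def shortFactors : List BTree :=
  [.leaf, .node .leaf .leaf, .node .leaf (.node .leaf .leaf)]

theorem exists_shortFactor_mul_comb (a : BTree) (b c d : CAs) :
    ∃ p ∈ shortFactors, ∃ b' c' d' : CAs,
      mk a * (b * (c * d)) = mk p * (b' * (c' * d')) := by
  induction h : a.degree using Nat.strong_induction_on generalizing a b c d with
  | _ n ih =>
    subst h
    match a, ih with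
    | .leaf, _ => exact ⟨.leaf, by simp [shortFactors], b, c, d, rfl⟩
    | .node .leaf .leaf, _ => exact ⟨_, by simp [shortFactors], b, c, d, rfl⟩
    | .node .leaf (.node .leaf .leaf), _ => exact ⟨_, by simp [shortFactors], b, c, d, rfl⟩
    | .node (.node p q) w, ih =>
      simp only [mk_node, comb3]
      exact ih _ (by simp only [BTree.degree]; omega) p _ _ _ rfl
    | .node .leaf (.node u (.node v w)), ih =>
      simp only [mk_node, rule1]
      exact ih _ (by simp only [BTree.degree]; omega) (.node .leaf u) _ _ _ rfl
    | .node .leaf (.node (.node u v) w), ih =>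
      simp only [mk_node, rule6]
      exact ih _ (by simp only [BTree.degree]; omega) (.node .leaf u) _ _ _ rfl

theorem exists_hasRedex_mul_eq (a : CAs) (b c d : BTree)
    (h : 6 ≤ b.arity + c.arity + d.arity) :
    ∃ s, HasRedex s ∧ a * (mk b * (mk c * mk d)) = a * s := by
  match d, h with
  | .node d₁ d₂, _ => exact ⟨_, hasRedex_right (mk b) (mk c) (mk d₁) (mk d₂), rfl⟩
  | .leaf, h =>
    match b, h with
    | .node (.node u v) w, _ => exact ⟨_, ⟨mk u, mk v, mk w, mk c * mk .leaf, rfl⟩, rfl⟩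
    | .node u (.node v w), _ =>
      exact ⟨_, hasRedex_right _ _ _ _, rule3 a (mk u) (mk v) (mk w) (mk c) (mk .leaf)⟩
    | .node .leaf .leaf, h =>
      match c, h with
      | .node (.node u v) w, _ =>
        exact ⟨_, HasRedex.mul_left ⟨mk u, mk v, mk w, mk .leaf, rfl⟩ _, rfl⟩
      | .node u (.node v w), _ =>
        exact ⟨_, hasRedex_right _ _ _ _,
          rule2 a (mk (.node .leaf .leaf)) (mk u) (mk v) (mk w) (mk .leaf)⟩
      | .node .leaf .leaf, h => simp [BTree.arity] at h
      | .leaf, h => simp [BTree.arity] at h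
    | .leaf, h =>
      match c, h with
      | .node (.node u v) w, _ =>
        exact ⟨_, HasRedex.mul_left ⟨mk u, mk v, mk w, mk .leaf, rfl⟩ _, rfl⟩
      | .node u (.node v w), _ =>
        exact ⟨_, hasRedex_right _ _ _ _, rule2 a (mk .leaf) (mk u) (mk v) (mk w) (mk .leaf)⟩
      | .node .leaf .leaf, h => simp [BTree.arity] at h
      | .leaf, h => simp [BTree.arity] at h

theorem exists_shortFactor_mul {t : BTree} (ht : 9 ≤ t.arity) (h : HasRedex (mk t)) :
    ∃ p ∈ shortFactors, ∃ s, HasRedex (mk s) ∧ mk t = mk (.node p s) := by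
  obtain ⟨a, b, c, d, h⟩ := h
  obtain ⟨a, rfl⟩ := mk_surjective a
  obtain ⟨p, hp, b', c', d', h'⟩ := exists_shortFactor_mul_comb a b c d
  obtain ⟨b', rfl⟩ := mk_surjective b'
  obtain ⟨c', rfl⟩ := mk_surjective c'
  obtain ⟨d', rfl⟩ := mk_surjective d'
  rw [comb3, h'] at h
  have har := arity_eq_of_mk_eq (t' := .node p (.node b' (.node c' d'))) h
  have hp3 : p.arity ≤ 3 := by
    have : ∀ p ∈ shortFactors, p.arity ≤ 3 := by decide
    exact this p hp
  simp only [BTree.arity] at har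
  obtain ⟨s, hs, hs'⟩ := exists_hasRedex_mul_eq (mk p) b' c' d' (by omega)
  obtain ⟨s, rfl⟩ := mk_surjective s
  exact ⟨p, hp, s, hs, h.trans hs'⟩

end CAs

/-! ### The four non-rigid classes in large arity -/

namespace BTree

/-- The right comb whose last internal node is replaced by a left comb of degree `2`. -/
def bentComb : ℕ → BTree
  | 0 => node (node leaf leaf) leaf
  | k + 1 => node leaf (bentComb k)

theorem arity_rightComb (k : ℕ) : (rightComb k).arity = k + 1 := by
  induction k with
  | zero => rfl
  | succ k ih => simp only [rightComb, arity, ih]; omega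

theorem arity_bentComb (k : ℕ) : (bentComb k).arity = k + 3 := by
  induction k with
  | zero => rfl
  | succ k ih => simp only [bentComb, arity, ih]; omega

theorem leftRank_mirror_rightComb (k : ℕ) : (rightComb k).mirror.leftRank = k := by
  induction k with
  | zero => rfl
  | succ k ih => simp [rightComb, mirror, leftRank, ih]

theorem leftRank_mirror_bentComb (k : ℕ) : (bentComb k).mirror.leftRank = k + 1 := by
  induction k with
  | zero => rfl
  | succ k ih => simp [bentComb, mirror, leftRank, ih]

/-- Representatives of the classes of arity `k + 8`, for `3 ≤ k`, of non-rigid trees. -/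
def combs (k : ℕ) : List BTree :=
  [rightComb (k + 7), bentComb (k + 5), node (node leaf leaf) (rightComb (k + 5)),
    node (node leaf leaf) (bentComb (k + 3))]

theorem arity_of_mem_combs {k : ℕ} {t : BTree} (h : t ∈ combs k) : t.arity = k + 8 := by
  simp only [combs, List.mem_cons, List.not_mem_nil, or_false] at h
  rcases h with rfl | rfl | rfl | rfl <;>
    simp only [arity, arity_rightComb, arity_bentComb] <;> omega

end BTree

namespace CAs

open BTree

theorem pairwise_mk_ne_combs (k : ℕ) : (combs k).Pairwise fun s t => mk s ≠ mk t := by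
  have key : ∀ s t : BTree, s.leftRank % 2 ≠ t.leftRank % 2 ∨
      s.mirror.leftRank % 2 ≠ t.mirror.leftRank % 2 → mk s ≠ mk t := by
    rintro s t (h | h) hst
    exacts [h (leftRank_mod_two_eq_of_mk_eq hst), h (leftRank_mirror_mod_two_eq_of_mk_eq hst)]
  simp only [combs, List.pairwise_cons, List.mem_cons, List.not_mem_nil, or_false,
    forall_eq_or_imp, forall_eq, List.Pairwise.nil, IsEmpty.forall_iff, implies_true, and_true]
  refine ⟨⟨?_, ?_, ?_⟩, ⟨?_, ?_⟩, ?_⟩ <;> apply key <;>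
    simp only [mirror, leftRank, rightComb, bentComb, leftRank_mirror_rightComb,
      leftRank_mirror_bentComb] <;>
    omega

theorem hasRedex_of_mem_combs {k : ℕ} {t : BTree} (h : t ∈ combs k) : HasRedex (mk t) := by
  simp only [combs, List.mem_cons, List.not_mem_nil, or_false] at h
  rcases h with rfl | rfl | rfl | rfl
  · exact hasRedex_right (mk leaf) (mk leaf) (mk leaf) (mk (rightComb (k + 4)))
  · exact hasRedex_right (mk leaf) (mk leaf) (mk leaf) (mk (bentComb (k + 2)))
  · exact hasRedex_right (mk (node leaf leaf)) (mk leaf) (mk leaf) (mk (rightComb (k + 3)))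
  · exact hasRedex_right (mk (node leaf leaf)) (mk leaf) (mk leaf) (mk (bentComb (k + 1)))

theorem mk_eq_of_eval_eq {t t' : BTree} (h : eval t = eval t') : mk t = mk t' := by
  rw [← mk_eval t, h, mk_eval]

theorem leaf_mul_rightComb (k : ℕ) :
    mk leaf * (mk (node leaf leaf) * mk (rightComb (k + 4))) = mk (bentComb (k + 5)) := by
  induction k using Nat.twoStepInduction with
  | zero =>
    exact mk_eq_of_eval_eq (t := node leaf (node (node leaf leaf) (rightComb 4)))
      (by decide +kernel)
  | one =>
    exact mk_eq_of_eval_eq (t := node leaf (node (node leaf leaf) (rightComb 5)))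
      (by decide +kernel)
  | more k ih _ =>
    rw [show mk (bentComb (k + 2 + 5)) = mk leaf * (mk leaf * mk (bentComb (k + 5))) from rfl, ← ih]
    exact rule5 (mk leaf) (mk leaf) (mk leaf) (mk leaf) (mk leaf) (mk leaf) (mk (rightComb (k + 3)))

theorem leaf_mul_bentComb (k : ℕ) :
    mk leaf * (mk (node leaf leaf) * mk (bentComb (k + 2))) = mk (rightComb (k + 7)) := by
  induction k using Nat.twoStepInduction with
  | zero =>
    exact mk_eq_of_eval_eq (t := node leaf (node (node leaf leaf) (bentComb 2)))
      (by decide +kernel)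
  | one =>
    exact mk_eq_of_eval_eq (t := node leaf (node (node leaf leaf) (bentComb 3)))
      (by decide +kernel)
  | more k ih _ =>
    rw [show mk (rightComb (k + 2 + 7)) = mk leaf * (mk leaf * mk (rightComb (k + 7))) from rfl,
      ← ih]
    exact rule5 (mk leaf) (mk leaf) (mk leaf) (mk leaf) (mk leaf) (mk leaf) (mk (bentComb (k + 1)))

end CAs

namespace CAs

open BTree

theorem exists_mem_combs_mul {k : ℕ} {p s : BTree} (hp : p ∈ shortFactors)
    (hs : s ∈ combs (k + 1)) : ∃ e ∈ combs (k + 1 + p.arity), mk (node p s) = mk e := by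
  have hR (j : ℕ) : mk (rightComb (j + 1)) = mk leaf * mk (rightComb j) := rfl
  have hB (j : ℕ) : mk (bentComb (j + 1)) = mk leaf * mk (bentComb j) := rfl
  have cR : mk (node leaf leaf) * (mk (node leaf leaf) * mk (rightComb (k + 6))) =
      mk (node leaf leaf) * mk (bentComb (k + 6)) := by
    rw [hB, ← leaf_mul_rightComb]
    exact rule5 (mk (node leaf leaf)) (mk leaf) (mk leaf) (mk leaf) (mk leaf) (mk leaf)
      (mk (rightComb (k + 3)))
  have cB : mk (node leaf leaf) * (mk (node leaf leaf) * mk (bentComb (k + 4))) =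
      mk (node leaf leaf) * mk (rightComb (k + 8)) := by
    rw [hR, ← leaf_mul_bentComb]
    exact rule5 (mk (node leaf leaf)) (mk leaf) (mk leaf) (mk leaf) (mk leaf) (mk leaf)
      (mk (bentComb (k + 1)))
  have dR (j : ℕ) : mk (node leaf (node leaf leaf)) * mk (rightComb (j + 8)) =
      mk (node leaf leaf) * mk (bentComb (j + 7)) := by
    rw [hB, hB, ← leaf_mul_rightComb]
    exact rule10 (mk leaf) (mk leaf) (mk leaf) (mk leaf) (mk leaf) (mk leaf) (mk leaf)
      (mk (rightComb (j + 4)))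
  have dB (j : ℕ) : mk (node leaf (node leaf leaf)) * mk (bentComb (j + 6)) =
      mk (node leaf leaf) * mk (rightComb (j + 9)) := by
    rw [hR, hR, ← leaf_mul_bentComb]
    exact rule10 (mk leaf) (mk leaf) (mk leaf) (mk leaf) (mk leaf) (mk leaf) (mk leaf)
      (mk (bentComb (j + 2)))
  have ddR : mk (node leaf (node leaf leaf)) * (mk (node leaf leaf) * mk (rightComb (k + 6))) =
      mk (node leaf leaf) * mk (rightComb (k + 9)) := by
    rw [← dB, hB, ← leaf_mul_rightComb]
    exact rule5 (mk (node leaf (node leaf leaf))) (mk leaf) (mk leaf) (mk leaf) (mk leaf)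
      (mk leaf) (mk (rightComb (k + 3)))
  have ddB : mk (node leaf (node leaf leaf)) * (mk (node leaf leaf) * mk (bentComb (k + 4))) =
      mk (node leaf leaf) * mk (bentComb (k + 7)) := by
    rw [← dR, hR, ← leaf_mul_bentComb]
    exact rule5 (mk (node leaf (node leaf leaf))) (mk leaf) (mk leaf) (mk leaf) (mk leaf)
      (mk leaf) (mk (bentComb (k + 1)))
  simp only [shortFactors, combs, List.mem_cons, List.not_mem_nil, or_false] at hp hs
  rcases hp with rfl | rfl | rfl <;> rcases hs with rfl | rfl | rfl | rfl <;>
    simp only [combs, List.mem_cons, List.not_mem_nil, or_false, exists_eq_or_imp, exists_eq_left]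
  · exact .inl rfl
  · exact .inr (.inl rfl)
  · exact .inr (.inl (leaf_mul_rightComb (k + 2)))
  · exact .inl (leaf_mul_bentComb (k + 2))
  · exact .inr (.inr (.inl rfl))
  · exact .inr (.inr (.inr rfl))
  · exact .inr (.inr (.inr cR))
  · exact .inr (.inr (.inl cB))
  · exact .inr (.inr (.inr (dR k)))
  · exact .inr (.inr (.inl (dB k)))
  · exact .inr (.inr (.inl ddR))
  · exact .inr (.inr (.inr ddB))

set_option synthInstance.maxSize 1000 in
set_option synthInstance.maxHeartbeats 400000 in
theorem mem_rigids_or_mul_mem_combs : ∀ p ∈ shortFactors, ∀ m ∈ [8, 9, 10],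
    11 ≤ p.arity + m → ∀ s ∈ nfs m, s ∈ rigids m ∨ BTree.mul p s ∈ combs (p.arity + m - 8) := by
  decide +kernel

theorem exists_mem_combs_mk_eq {k : ℕ} {t : BTree} (ht : t.arity = k + 11)
    (h : HasRedex (mk t)) : ∃ e ∈ combs (k + 3), mk t = mk e := by
  induction k using Nat.strong_induction_on generalizing t with
  | _ k ih =>
    obtain ⟨p, hp, s, hs, hts⟩ := exists_shortFactor_mul (by omega) h
    have har := arity_eq_of_mk_eq hts
    simp only [arity] at har
    have hp1 := one_le_arity p
    have hp3 : p.arity ≤ 3 := by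
      have : ∀ p ∈ shortFactors, p.arity ≤ 3 := by decide
      exact this p hp
    by_cases hk : p.arity ≤ k
    · obtain ⟨e, he, hse⟩ := ih (k - p.arity) (by omega) (t := s) (by omega) hs
      obtain ⟨e', he', hee'⟩ := exists_mem_combs_mul hp he
      refine ⟨e', ?_, ?_⟩
      · rwa [show k - p.arity + 2 + 1 + p.arity = k + 3 by omega] at he'
      · rw [hts, ← hee', mk_node, mk_node, hse]
    · have hm : s.arity ∈ [8, 9, 10] := by
        simp only [List.mem_cons, List.not_mem_nil, or_false]
        omega
      rcases mem_rigids_or_mul_mem_combs p hp _ hm (by omega) _ (eval_mem_nfs s) with hr | hc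
      · rw [← mk_eval] at hs
        exact absurd hs (not_hasRedex_of_isRigid (isRigid_of_mem_rigids hr))
      · refine ⟨BTree.mul p (eval s), ?_, ?_⟩
        · rwa [show p.arity + s.arity - 8 = k + 3 by omega] at hc
        · rw [hts, BTree.mul, mk_mulNF, mk_eval, mk_node]

end CAs

/-! ### Counting classes -/

open BTree CAs

theorem classCount_eq_length {n : ℕ} {L : List BTree} (nodup : L.Nodup)
    (har : ∀ s ∈ L, s.arity = n) (surj : ∀ t : BTree, t.arity = n → ∃ s ∈ L, mk t = mk s)
    (inj : ∀ s ∈ L, ∀ s' ∈ L, mk s = mk s' → s = s') : classCount (CAsCongr 3) n = L.length := by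
  let R : {t : BTree // t.arity = n} → {t : BTree // t.arity = n} → Prop :=
    fun a b => CAsCongr 3 a.1 b.1
  have hR : Equivalence R := isCombCongr_casCongr.equiv.comap _
  let f : {s // s ∈ L.toFinset} → Quot R :=
    fun s => Quot.mk _ ⟨s.1, har _ (List.mem_toFinset.1 s.2)⟩
  have hf : Function.Bijective f := by
    constructor
    · rintro ⟨s, hs⟩ ⟨s', hs'⟩ h
      exact Subtype.ext (inj s (List.mem_toFinset.1 hs) s' (List.mem_toFinset.1 hs')
        (mk_eq_mk.2 ((hR.quot_mk_eq_iff _ _).1 h)))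
    · rintro ⟨t, ht⟩
      obtain ⟨s, hs, hts⟩ := surj t ht
      exact ⟨⟨s, List.mem_toFinset.2 hs⟩, (hR.quot_mk_eq_iff _ _).2 (mk_eq_mk.1 hts.symm)⟩
  calc classCount (CAsCongr 3) n = Nat.card (Quot R) := rfl
    _ = Nat.card {s // s ∈ L.toFinset} := (Nat.card_eq_of_bijective f hf).symm
    _ = L.length := by
      rw [Nat.card_eq_fintype_card, Fintype.card_coe, List.toFinset_card_of_nodup nodup]

theorem classCount_eq_length_nfs {n : ℕ} (hn : 1 ≤ n) (hn' : n ≤ 10) :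
    classCount (CAsCongr 3) n = (nfs n).length := by
  have har (s) (hs : s ∈ nfs n) : s.arity = n := by
    obtain ⟨t, rfl, rfl⟩ := exists_eval_eq hn hs
    exact arity_eq_of_mk_eq (mk_eval t)
  refine classCount_eq_length (nodup_nfs n) har ?_ ?_
  · rintro t rfl
    exact ⟨_, eval_mem_nfs t, (mk_eval t).symm⟩
  · intro s hs s' hs' h
    obtain ⟨t, rfl, rfl⟩ := exists_eval_eq hn hs
    obtain ⟨t', -, rfl⟩ := exists_eval_eq hn hs'
    rw [mk_eval, mk_eval] at h
    exact eval_eq_of_mk_eq h hn'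

theorem classCount_of_le {n : ℕ} (hn : 11 ≤ n) : classCount (CAsCongr 3) n = n + 3 := by
  obtain ⟨k, rfl⟩ : ∃ k, n = k + 11 := ⟨n - 11, by omega⟩
  have hdisj (s) (hs : s ∈ rigids (k + 11)) (s') (hs' : s' ∈ combs (k + 3)) : mk s ≠ mk s' :=
    fun h => not_hasRedex_of_isRigid (isRigid_of_mem_rigids hs) (h ▸ hasRedex_of_mem_combs hs')
  have hcombs (s) (hs : s ∈ combs (k + 3)) (s') (hs' : s' ∈ combs (k + 3)) (h : mk s = mk s') :
      s = s' := by
    have : Std.Symm fun s t : BTree => mk s ≠ mk t := ⟨fun _ _ h => h.symm⟩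
    by_contra hne
    exact (pairwise_mk_ne_combs (k + 3)).forall hs hs' hne h
  rw [classCount_eq_length (L := rigids (k + 11) ++ combs (k + 3))]
  · simp [length_rigids, combs]
  · refine List.nodup_append.2 ⟨nodup_rigids _, ?_, fun s hs s' hs' h => ?_⟩
    · exact (pairwise_mk_ne_combs _).imp fun h h' => h (congrArg mk h')
    · exact hdisj s hs s' hs' (congrArg mk h)
  · intro s hs
    rcases List.mem_append.1 hs with hs | hs
    exacts [arity_of_mem_rigids hs, arity_of_mem_combs hs]
  · intro t ht
    rcases isRigid_or_hasRedex t with h | h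
    · exact ⟨t, List.mem_append_left _ (ht ▸ h.mem_rigids (by omega)), rfl⟩
    · obtain ⟨e, he, hte⟩ := exists_mem_combs_mk_eq ht h
      exact ⟨e, List.mem_append_right _ he, hte⟩
  · intro s hs s' hs' h
    rcases List.mem_append.1 hs with hs | hs
    · exact (isRigid_of_mem_rigids hs).eq_of_mk_eq h
    · rcases List.mem_append.1 hs' with hs' | hs'
      · exact ((isRigid_of_mem_rigids hs').eq_of_mk_eq h.symm).symm
      · exact hcombs s hs s' hs' h

theorem classCount_values : ([1, 2, 3, 4, 5, 6, 7, 8, 9, 10].map (classCount (CAsCongr 3))) =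
    [1, 1, 2, 4, 8, 14, 20, 19, 16, 14] := by
  have h : [1, 2, 3, 4, 5, 6, 7, 8, 9, 10].map (fun n => (nfs n).length) =
      [1, 1, 2, 4, 8, 14, 20, 19, 16, 14] := by
    decide +kernel
  rw [← h]
  refine List.map_congr_left fun n hn => classCount_eq_length_nfs ?_ ?_ <;>
    · revert n
      decide

/-- The Hilbert series of `CAs₃` is
`t (1 - t + t² + t³ + 2t⁴ + 2t⁵ - 7t⁷ - 2t⁸ + t⁹ + 2t¹⁰ + t¹¹) / (1 - t)²`. -/
theorem stmt10 :
    (1 - PowerSeries.X : PowerSeries ℤ) ^ 2 *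
        PowerSeries.mk (fun n : ℕ => if n = 0 then 0 else (classCount (CAsCongr 3) n : ℤ)) =
      PowerSeries.X * (1 - PowerSeries.X + PowerSeries.X ^ 2 + PowerSeries.X ^ 3 +
        2 * PowerSeries.X ^ 4 + 2 * PowerSeries.X ^ 5 - 7 * PowerSeries.X ^ 7 -
        2 * PowerSeries.X ^ 8 + PowerSeries.X ^ 9 + 2 * PowerSeries.X ^ 10 +
        PowerSeries.X ^ 11) := by
  have hv := classCount_values
  simp only [List.map_cons, List.map_nil, List.cons.injEq, and_true] at hv
  obtain ⟨h1, h2, h3, h4, h5, h6, h7, h8, h9, h10⟩ := hv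
  generalize hF : PowerSeries.mk (fun n : ℕ => if n = 0 then 0 else
    (classCount (CAsCongr 3) n : ℤ)) = F
  have hcoeff (n : ℕ) : PowerSeries.coeff n F =
      if n = 0 then 0 else (classCount (CAsCongr 3) n : ℤ) := by
    rw [← hF, PowerSeries.coeff_mk]
  have hC2 : (PowerSeries.C 2 : PowerSeries ℤ) = 2 := map_ofNat _ 2
  have hC7 : (PowerSeries.C 7 : PowerSeries ℤ) = 7 := map_ofNat _ 7
  have hl : (1 - PowerSeries.X) ^ 2 * F = F - PowerSeries.C 2 * (PowerSeries.X ^ 1 * F) +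
      PowerSeries.X ^ 2 * F := by
    rw [hC2]
    ring
  have hr : (PowerSeries.X * (1 - PowerSeries.X + PowerSeries.X ^ 2 + PowerSeries.X ^ 3 +
        2 * PowerSeries.X ^ 4 + 2 * PowerSeries.X ^ 5 - 7 * PowerSeries.X ^ 7 -
        2 * PowerSeries.X ^ 8 + PowerSeries.X ^ 9 + 2 * PowerSeries.X ^ 10 +
        PowerSeries.X ^ 11) : PowerSeries ℤ) =
      PowerSeries.X ^ 1 - PowerSeries.X ^ 2 + PowerSeries.X ^ 3 + PowerSeries.X ^ 4 +
        PowerSeries.C 2 * PowerSeries.X ^ 5 + PowerSeries.C 2 * PowerSeries.X ^ 6 -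
        PowerSeries.C 7 * PowerSeries.X ^ 8 - PowerSeries.C 2 * PowerSeries.X ^ 9 +
        PowerSeries.X ^ 10 + PowerSeries.C 2 * PowerSeries.X ^ 11 + PowerSeries.X ^ 12 := by
    rw [hC2, hC7]
    ring
  rw [hl, hr]
  ext n
  simp only [map_add, map_sub, PowerSeries.coeff_C_mul, PowerSeries.coeff_X_pow_mul',
    PowerSeries.coeff_X_pow, hcoeff]
  obtain hn | hn := lt_or_ge n 14
  · interval_cases n <;>
      simp [h1, h2, h3, h4, h5, h6, h7, h8, h9, h10, classCount_of_le]
  · obtain ⟨m, rfl⟩ : ∃ m, n = m + 14 := ⟨n - 14, by omega⟩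
    simp only [Nat.reduceEqDiff, Nat.reduceSubDiff, Nat.reduceLeDiff, reduceIte,
      Nat.add_eq_zero_iff, OfNat.ofNat_ne_zero, and_false,
      classCount_of_le (n := m + 14) (by omega), classCount_of_le (n := m + 13) (by omega),
      classCount_of_le (n := m + 12) (by omega)]
    push_cast
    ring
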